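/- arXiv:2312.02412 — 3 statements merged into one kernel-verified Lean document; each statement's English description precedes it below -/
import Mathlib

section
/- If an acceptable color sequence (s_0, s_1, …, s_k) ∈ 𝔄(C, a, H, V) has the unbounded sequence property, then there exists a color c_∞ ∈ C such that the extended sequence (s_0, s_1, …, s_k, c_∞) is an acceptable color sequence with the unbounded sequence property. -/
/-- The diagonal map `D(x, y) = (x+y)(x+y+1)/2 + x`. -/
def diagMap (p : ℕ × ℕ) : ℕ := (p.1 + p.2) * (p.1 + p.2 + 1) / 2 + p.1

/-- A finite color sequence `(a_0, …, a_m)` (a nonempty list) is an acceptable color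
sequence for the coloring system `(C, a, H, V)`: the induced partial coloring
`g(x, y) = a_{D(x,y)}` on `{(x,y) : D(x,y) ≤ m}` colors the origin `a` and respects
the horizontal rules `H` and vertical rules `V`. -/
def IsAcceptableSeq {C : Type} (a : C) (H V : Set (C × C)) (s : List C) : Prop :=
  s ≠ [] ∧
  s.head? = some a ∧
  (∀ x y : ℕ, ∀ (h1 : diagMap (x, y) < s.length) (h2 : diagMap (x + 1, y) < s.length),
    (s.get ⟨diagMap (x, y), h1⟩, s.get ⟨diagMap (x + 1, y), h2⟩) ∈ H) ∧
  (∀ x y : ℕ, ∀ (h1 : diagMap (x, y) < s.length) (h2 : diagMap (x, y + 1) < s.length),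
    (s.get ⟨diagMap (x, y), h1⟩, s.get ⟨diagMap (x, y + 1), h2⟩) ∈ V)

/-- A sequence `s = (s_0, …, s_k)` has the unbounded sequence property if for every
`M ≥ k` there is an acceptable color sequence of length `M + 1` having `s` as a prefix. -/
def HasUSP {C : Type} (a : C) (H V : Set (C × C)) (s : List C) : Prop :=
  ∀ M : ℕ, s.length ≤ M + 1 →
    ∃ t : List C, IsAcceptableSeq a H V t ∧ t.length = M + 1 ∧ s <+: t

/-- The space `𝔄(C, a, H, V)` has the unbounded sequence property if it contains
an acceptable color sequence of length `M + 1` for every natural number `M`. -/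
def SpaceUSP {C : Type} (a : C) (H V : Set (C × C)) : Prop :=
  ∀ M : ℕ, ∃ s : List C, IsAcceptableSeq a H V s ∧ s.length = M + 1

/-- An acceptable coloring of the coloring system `(C, a, H, V)`. -/
def IsAcceptableColoring {C : Type} (a : C) (H V : Set (C × C)) (f : ℕ × ℕ → C) : Prop :=
  f (0, 0) = a ∧
  (∀ x y : ℕ, (f (x, y), f (x + 1, y)) ∈ H) ∧
  (∀ x y : ℕ, (f (x, y), f (x, y + 1)) ∈ V)

/-- A nonempty prefix of an acceptable color sequence is acceptable. -/
theorem IsAcceptableSeq.of_prefix {C : Type} {a : C} {H V : Set (C × C)} {s t : List C}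
    (ht : IsAcceptableSeq a H V t) (hst : s <+: t) (hs : s ≠ []) : IsAcceptableSeq a H V s := by
  obtain ⟨-, hhead, hH, hV⟩ := ht
  obtain ⟨u, rfl⟩ := hst
  refine ⟨hs, ?_, fun x y h1 h2 => ?_, fun x y h1 h2 => ?_⟩
  · rwa [List.head?_append_of_ne_nil s hs] at hhead
  · have h := hH x y (by rw [List.length_append]; omega) (by rw [List.length_append]; omega)
    simpa [List.getElem_append_left, h1, h2] using h
  · have h := hV x y (by rw [List.length_append]; omega) (by rw [List.length_append]; omega)
    simpa [List.getElem_append_left, h1, h2] using h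

/-- If an acceptable color sequence `(s_0, …, s_k)` has the unbounded sequence property,
then there is a color `c∞ ∈ C` such that `(s_0, …, s_k, c∞)` is an acceptable color
sequence with the unbounded sequence property. -/
theorem exists_extension_with_usp {C : Type} [Finite C] (a : C) (H V : Set (C × C))
    (s : List C) (hs : IsAcceptableSeq a H V s) (husp : HasUSP a H V s) :
    ∃ c : C, IsAcceptableSeq a H V (s ++ [c]) ∧ HasUSP a H V (s ++ [c]) := by
  have hext : ∀ n : ℕ, ∃ c : C, ∃ t : List C,
      IsAcceptableSeq a H V t ∧ t.length = s.length + n + 1 ∧ s ++ [c] <+: t := by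
    intro n
    obtain ⟨t, ht, hlen, u, rfl⟩ := husp (s.length + n) (by omega)
    cases u with
    | nil => simp at hlen; omega
    | cons c u => exact ⟨c, _, ht, hlen, u, by simp⟩
  choose color hcolor using hext
  obtain ⟨c, hc⟩ := Finite.exists_infinite_fiber color
  have husp' : HasUSP a H V (s ++ [c]) := by
    intro M hM
    obtain ⟨n, hn, hMn⟩ := (Set.infinite_coe_iff.mp hc).exists_gt M
    obtain ⟨t, ht, hlen, hpre⟩ := hcolor n
    rw [show color n = c from hn] at hpre
    have hlen' : (t.take (M + 1)).length = M + 1 := by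
      rw [List.length_take]; omega
    refine ⟨t.take (M + 1), ht.of_prefix (List.take_prefix _ _) ?_, hlen', ?_⟩
    · exact List.ne_nil_of_length_pos (by omega)
    · exact List.prefix_take_iff.mpr ⟨hpre, hM⟩
  obtain ⟨t, ht, -, hpre⟩ := husp' s.length (by simp)
  exact ⟨c, ht.of_prefix hpre (by simp), husp'⟩
end

section
/- If for every natural number M there exists an acceptable color sequence in 𝔄(C, a, H, V) of length greater than M, then there exists an acceptable coloring of the coloring system (C, a, H, V), i.e., a function f : ℕ × ℕ → C with f(0,0) = a, (f(x,y), f(x+1,y)) ∈ H for all x, y, and (f(x,y), f(x,y+1)) ∈ V for all x, y. -/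
/-- Along an ultrafilter, a function to a finite type is eventually constant. -/
theorem Ultrafilter.exists_eventually_eq {ι C : Type*} [Finite C] (U : Ultrafilter ι)
    (g : ι → C) : ∃ c, ∀ᶠ n in (U : Filter ι), g n = c := by
  obtain ⟨c, hc⟩ := (U.map g).eq_pure_of_finite
  refine ⟨c, ?_⟩
  have hmem : ({c} : Set C) ∈ U.map g := by rw [hc]; exact Set.mem_singleton c
  exact hmem

/-- If for every natural number `M` there is an acceptable color sequence in
`𝔄(C, a, H, V)` of length greater than `M`, then there exists an acceptable coloring
of the coloring system `(C, a, H, V)`. -/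
theorem exists_acceptable_coloring {C : Type} [Finite C] (a : C) (H V : Set (C × C))
    (h : ∀ M : ℕ, ∃ s : List C, IsAcceptableSeq a H V s ∧ M < s.length) :
    ∃ f : ℕ × ℕ → C, IsAcceptableColoring a H V f := by
  choose s hs hlen using h
  let U : Ultrafilter ℕ := Filter.hyperfilter ℕ
  have hlarge (k : ℕ) : ∀ᶠ n in (U : Filter ℕ), k < (s n).length := by
    have hle : ∀ᶠ n in (U : Filter ℕ), k ≤ n :=
      Nat.hyperfilter_le_atTop (Filter.eventually_ge_atTop k)
    exact hle.mono fun n hn => hn.trans_lt (hlen n)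
  choose f hf using fun p : ℕ × ℕ =>
    U.exists_eventually_eq fun n => (s n).getD (diagMap p) a
  refine ⟨f, ?_, fun x y => ?_, fun x y => ?_⟩
  · obtain ⟨n, hn⟩ := (hf (0, 0)).exists
    rw [← hn]
    have hhead := (hs n).2.1
    rw [List.head?_eq_getElem?] at hhead
    simp [diagMap, List.getD_eq_getElem?_getD, hhead]
  · obtain ⟨n, ⟨h₁, h₂⟩, hl₁, hl₂⟩ := (((hf (x, y)).and (hf (x + 1, y))).and
      ((hlarge (diagMap (x, y))).and (hlarge (diagMap (x + 1, y))))).exists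
    rw [← h₁, ← h₂, List.getD_eq_getElem _ _ hl₁, List.getD_eq_getElem _ _ hl₂]
    exact (hs n).2.2.1 x y hl₁ hl₂
  · obtain ⟨n, ⟨h₁, h₂⟩, hl₁, hl₂⟩ := (((hf (x, y)).and (hf (x, y + 1))).and
      ((hlarge (diagMap (x, y))).and (hlarge (diagMap (x, y + 1))))).exists
    rw [← h₁, ← h₂, List.getD_eq_getElem _ _ hl₁, List.getD_eq_getElem _ _ hl₂]
    exact (hs n).2.2.2 x y hl₁ hl₂
end

section
/- If the coloring system (C, a, H, V) admits no acceptable coloring, then there exists a natural number M such that every acceptable color sequence in 𝔄(C, a, H, V) has length less than M. -/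
/-- A function with values in a finite type is eventually constant along any ultrafilter. -/
theorem Ultrafilter.exists_eventually_eq_of_finite {ι C : Type*} [Finite C] (l : Ultrafilter ι)
    (u : ι → C) : ∃ c, ∀ᶠ n in (l : Filter ι), u n = c := by
  obtain ⟨c, hc⟩ := (l.map u).eq_pure_of_finite
  refine ⟨c, ?_⟩
  have hmem : ({c} : Set C) ∈ l.map u := by
    rw [hc]
    exact Ultrafilter.mem_pure.2 rfl
  exact hmem

/-- Acceptable color sequences of unbounded length have an acceptable coloring as a limit. -/
theorem exists_isAcceptableColoring_of_unbounded {C : Type} [Finite C] {a : C} {H V : Set (C × C)}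
    (h : ∀ M : ℕ, ∃ s : List C, IsAcceptableSeq a H V s ∧ M ≤ s.length) :
    ∃ f : ℕ × ℕ → C, IsAcceptableColoring a H V f := by
  choose s hs hlen using h
  let l : Ultrafilter ℕ := Filter.hyperfilter ℕ
  have hl : (l : Filter ℕ) ≤ Filter.atTop := Nat.hyperfilter_le_atTop
  have long (k : ℕ) : ∀ᶠ n in (l : Filter ℕ), k < (s n).length :=
    hl ((Filter.eventually_gt_atTop k).mono fun n hn => hn.trans_le (hlen n))
  choose f hf using fun p : ℕ × ℕ =>
    l.exists_eventually_eq_of_finite fun n => (s n).getD (diagMap p) a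
  have hget (p : ℕ × ℕ) : ∀ᶠ n in (l : Filter ℕ),
      ∃ hp : diagMap p < (s n).length, (s n).get ⟨diagMap p, hp⟩ = f p := by
    filter_upwards [long (diagMap p), hf p] with n hp hn
    refine ⟨hp, ?_⟩
    rw [← hn, List.getD_eq_getElem _ _ hp, List.get_eq_getElem]
  refine ⟨f, ?_, fun x y => ?_, fun x y => ?_⟩
  · obtain ⟨n, hn⟩ := (hf (0, 0)).exists
    rw [← hn]
    simp [diagMap, List.getD_eq_getElem?_getD, ← List.head?_eq_getElem?, (hs n).2.1]
  · obtain ⟨n, ⟨h₁, e₁⟩, h₂, e₂⟩ := ((hget (x, y)).and (hget (x + 1, y))).exists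
    rw [← e₁, ← e₂]
    exact (hs n).2.2.1 x y h₁ h₂
  · obtain ⟨n, ⟨h₁, e₁⟩, h₂, e₂⟩ := ((hget (x, y)).and (hget (x, y + 1))).exists
    rw [← e₁, ← e₂]
    exact (hs n).2.2.2 x y h₁ h₂

/-- If the coloring system `(C, a, H, V)` admits no acceptable coloring, then there is
a natural number `M` such that every acceptable color sequence in `𝔄(C, a, H, V)` has
length less than `M`. -/
theorem exists_bound_of_no_coloring {C : Type} [Finite C] (a : C) (H V : Set (C × C))
    (h : ¬ ∃ f : ℕ × ℕ → C, IsAcceptableColoring a H V f) :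
    ∃ M : ℕ, ∀ s : List C, IsAcceptableSeq a H V s → s.length < M := by
  contrapose! h
  exact exists_isAcceptableColoring_of_unbounded h
end
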